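/- arXiv:1412.2253 — 2 statements merged into one kernel-verified Lean document; each statement's English description precedes it below -/
import Mathlib

section
/- Let A be a nontrivial pseudo BL-algebra in which every maximal filter is normal. Then for every n ≥ 1 and all x, y ∈ A: (((x⇝y)ⁿ)⁻)² ≤ ((x→y)^{2n})⁻. -/
/-- A pseudo BL-algebra: a bounded lattice `(A; ∨, ∧, 0, 1)` together with a monoid
structure `(A; ·, 1)` and two residua `→` (`himp`) and `⇝` (`rimp`) satisfying the
residuation, divisibility and prelinearity conditions. -/
class PseudoBL (A : Type*) extends Lattice A, Monoid A, Zero A where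
  himp : A → A → A
  rimp : A → A → A
  zero_le : ∀ x : A, (0 : A) ≤ x
  le_one : ∀ x : A, x ≤ 1
  mul_le_iff_himp : ∀ x y z : A, x * y ≤ z ↔ x ≤ himp y z
  mul_le_iff_rimp : ∀ x y z : A, x * y ≤ z ↔ y ≤ rimp x z
  himp_mul_inf : ∀ x y : A, himp x y * x = x ⊓ y
  mul_rimp_inf : ∀ x y : A, y * rimp y x = x ⊓ y
  prelin_himp : ∀ x y : A, himp x y ⊔ himp y x = 1
  prelin_rimp : ∀ x y : A, rimp x y ⊔ rimp y x = 1

namespace PseudoBL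

variable {A : Type*} [PseudoBL A]

/-- The left negation `x⁻ := x → 0`. -/
def lneg (x : A) : A := himp x 0

/-- A filter: a nonempty subset closed under `·` and upward closed. -/
def IsFilter (F : Set A) : Prop :=
  F.Nonempty ∧ (∀ x ∈ F, ∀ y ∈ F, x * y ∈ F) ∧ ∀ x ∈ F, ∀ y : A, x ≤ y → y ∈ F

/-- A maximal filter: a proper filter not properly contained in any proper filter. -/
def IsMaximalFilter (F : Set A) : Prop :=
  IsFilter F ∧ F ≠ Set.univ ∧
    ∀ G : Set A, IsFilter G → G ≠ Set.univ → F ⊆ G → F = G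

/-- A normal filter: `x→y ∈ F` iff `x⇝y ∈ F`. -/
def IsNormalFilter (F : Set A) : Prop :=
  ∀ x y : A, himp x y ∈ F ↔ rimp x y ∈ F

end PseudoBL

open PseudoBL

namespace PseudoBL

section Abstract

variable {B : Type*} [Monoid B] {L : B → B → Prop}

theorem aux_pow_mono (hr : ∀ x, L x x) (ht : ∀ x y z, L x y → L y z → L x z)
    (hl : ∀ x y z, L x y → L (z * x) (z * y)) (hrm : ∀ x y z, L x y → L (x * z) (y * z))
    (x y : B) (h : L x y) (n : ℕ) : L (x ^ n) (y ^ n) := by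
  induction n with
  | zero => simpa using hr 1
  | succ k ih =>
    rw [pow_succ, pow_succ]
    exact ht _ _ _ (hrm _ _ _ ih) (hl _ _ _ h)

theorem aux_comm (hr : ∀ x, L x x) (ht : ∀ x y z, L x y → L y z → L x z)
    (htot : ∀ x y, L x y ∨ L y x)
    (hl : ∀ x y z, L x y → L (z * x) (z * y)) (hrm : ∀ x y z, L x y → L (x * z) (y * z))
    (h1 : ∀ x, L x 1)
    (hdiv : ∀ x y, L x y → ∃ r, L x (y * r) ∧ L (y * r) x)
    (res : B → B → B) (hres : ∀ x y z, L (x * y) z ↔ L y (res x z))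
    (hnil : ∀ x, ¬ L 1 x → ∃ k : ℕ, ∀ y, L (x ^ k) y) (x y : B) : L (x * y) (y * x) := by
  have hm : ∀ a b c d, L a b → L c d → L (a * c) (b * d) := fun a b c d h h' =>
    ht _ _ _ (hrm _ _ c h) (hl _ _ b h')
  have sand : ∀ w, ¬ L 1 w → ∀ x, ∃ m : ℕ, L x (w ^ m) ∧ L (w ^ (m + 1)) x := by
    intro w hw x
    classical
    have hex : ∃ k : ℕ, L (w ^ k) x := by
      obtain ⟨k, hk⟩ := hnil w hw
      exact ⟨k, hk x⟩
    rcases hk : Nat.find hex with _ | m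
    · have h0 := Nat.find_spec hex
      rw [hk, pow_zero] at h0
      refine ⟨0, by simpa using h1 x, ?_⟩
      exact ht _ _ _ (h1 _) h0
    · have h0 := Nat.find_spec hex
      rw [hk] at h0
      have h2 : ¬ L (w ^ m) x := Nat.find_min hex (by omega)
      exact ⟨m, (htot _ _).resolve_right h2, h0⟩
  -- coatom case
  have coat : ∀ c, ¬ L 1 c → (∀ w, ¬ L 1 w → L w c) → L (x * y) (y * x) := by
    intro c hc hmax
    have rep : ∀ x, ∃ m : ℕ, L x (c ^ m) ∧ L (c ^ m) x := by
      intro x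
      obtain ⟨m, hm1, hm2⟩ := sand c hc x
      obtain ⟨q, hq1, hq2⟩ := hdiv _ _ hm1
      by_cases hq : L 1 q
      · refine ⟨m, hm1, ?_⟩
        have := hl _ _ (c ^ m) hq
        rw [mul_one] at this
        exact ht _ _ _ this hq2
      · refine ⟨m + 1, ?_, hm2⟩
        rw [pow_succ]
        exact ht _ _ _ hq1 (hl _ _ _ (hmax q hq))
    obtain ⟨m, a1, a2⟩ := rep x
    obtain ⟨k, b1, b2⟩ := rep y
    have e1 := hm _ _ _ _ a1 b1
    have e2 := hm _ _ _ _ b2 a2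
    rw [← pow_add] at e1 e2
    rw [add_comm] at e2
    exact ht _ _ _ e1 e2
  have half : ∀ s t, ¬ L t s → ¬ L 1 t → ∃ w, ¬ L 1 w ∧ L s (w * w) := by
    intro s t hts h1t
    obtain ⟨q, hq1, hq2⟩ := hdiv s t ((htot _ _).resolve_right hts)
    have hq : ¬ L 1 q := by
      intro h
      have := hl _ _ t h
      rw [mul_one] at this
      exact hts (ht _ _ _ this hq2)
    rcases htot t q with h | h
    · exact ⟨q, hq, ht _ _ _ hq1 (hrm _ _ _ h)⟩
    · exact ⟨t, h1t, ht _ _ _ hq1 (hl _ _ _ h)⟩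
  -- main claim for the reverse pair
  by_contra hcon
  set r := res (x * y) (y * x) with hrdef
  have hr1 : ¬ L 1 r := by
    intro h
    have := (hres (x * y) 1 (y * x)).2 h
    rw [mul_one] at this
    exact hcon this
  have key : ∀ w, ¬ L 1 w → L (w * w) r := by
    intro w hw
    obtain ⟨m, a1, a2⟩ := sand w hw x
    obtain ⟨k, b1, b2⟩ := sand w hw y
    have e1 := hrm _ _ (w * w) (hm _ _ _ _ a1 b1)
    have e2 := hm _ _ _ _ b2 a2
    have e : w ^ m * w ^ k * (w * w) = w ^ (k + 1) * w ^ (m + 1) := by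
      rw [← pow_two, ← pow_add, ← pow_add, ← pow_add]
      congr 1
      omega
    rw [e] at e1
    exact (hres _ _ _).1 (ht _ _ _ e1 e2)
  by_cases hc : ∀ w, ¬ L 1 w → L w r
  · exact hcon (coat r hr1 hc)
  · push Not at hc
    obtain ⟨s, hs1, hs2⟩ := hc
    by_cases hc' : ∀ w, ¬ L 1 w → L w s
    · exact hcon (coat s hs1 hc')
    · push Not at hc'
      obtain ⟨t, ht1, ht2⟩ := hc'
      obtain ⟨w, hw1, hw2⟩ := half s t ht2 ht1
      exact hs2 (ht _ _ _ hw2 (key w hw1))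

end Abstract

section Basic

variable {A : Type*} [PseudoBL A]

theorem p_mul_left {x y : A} (z : A) (h : x ≤ y) : z * x ≤ z * y := by
  rw [mul_le_iff_rimp]
  exact h.trans ((mul_le_iff_rimp _ _ _).1 le_rfl)

theorem p_mul_right {x y : A} (z : A) (h : x ≤ y) : x * z ≤ y * z := by
  rw [mul_le_iff_himp]
  exact h.trans ((mul_le_iff_himp _ _ _).1 le_rfl)

theorem p_mul {x y u v : A} (h : x ≤ y) (h' : u ≤ v) : x * u ≤ y * v :=
  (p_mul_right u h).trans (p_mul_left y h')

theorem p_mul_le_left (x y : A) : x * y ≤ x := by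
  simpa using p_mul_left x (le_one y)

theorem p_mul_le_right (x y : A) : x * y ≤ y := by
  simpa using p_mul_right y (le_one x)

theorem p_himp_mul (x y : A) : himp x y * x ≤ y := (mul_le_iff_himp _ _ _).2 le_rfl

theorem p_mul_rimp (x y : A) : x * rimp x y ≤ y := (mul_le_iff_rimp _ _ _).2 le_rfl

theorem p_mul_sup_le {x y z w : A} (h1 : x * y ≤ w) (h2 : x * z ≤ w) : x * (y ⊔ z) ≤ w := by
  rw [mul_le_iff_rimp] at *
  exact sup_le h1 h2

theorem p_sup_mul_le {x y z w : A} (h1 : y * x ≤ w) (h2 : z * x ≤ w) : (y ⊔ z) * x ≤ w := by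
  rw [mul_le_iff_himp] at *
  exact sup_le h1 h2

theorem p_himp_eq_one {x y : A} (h : x ≤ y) : himp x y = 1 := by
  apply le_antisymm (le_one _)
  rw [← mul_le_iff_himp, one_mul]
  exact h

/-- The filter of elements coprime to `u`. -/
theorem coprime_filter (u : A) : IsFilter {w : A | w ⊔ u = 1} := by
  refine ⟨⟨1, ?_⟩, ?_, ?_⟩
  · exact sup_eq_left.2 (le_one u)
  · intro a (ha : a ⊔ u = 1) b (hb : b ⊔ u = 1)
    apply le_antisymm (le_one _)
    calc (1 : A) = (a ⊔ u) * (b ⊔ u) := by rw [ha, hb, one_mul]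
      _ ≤ a * b ⊔ u := by
        apply p_sup_mul_le
        · apply p_mul_sup_le
          · exact le_sup_left
          · exact (p_mul_le_right _ _).trans le_sup_right
        · exact (p_mul_le_left _ _).trans le_sup_right
  · intro a (ha : a ⊔ u = 1) b hab
    apply le_antisymm (le_one _)
    rw [← ha]
    exact sup_le_sup_right hab u

theorem IsFilter.one_mem {F : Set A} (h : IsFilter F) : (1 : A) ∈ F := by
  obtain ⟨a, ha⟩ := h.1
  exact h.2.2 a ha 1 (le_one a)

theorem IsFilter.pow_mem {F : Set A} (h : IsFilter F) {a : A} (ha : a ∈ F) (n : ℕ) :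
    a ^ n ∈ F := by
  induction n with
  | zero => simpa using h.one_mem
  | succ k ih => rw [pow_succ]; exact h.2.1 _ ih _ ha

theorem IsFilter.ne_univ_iff {F : Set A} (h : IsFilter F) : F ≠ Set.univ ↔ (0 : A) ∉ F := by
  constructor
  · intro h1 h0
    exact h1 (Set.eq_univ_of_forall fun x => h.2.2 0 h0 x (zero_le x))
  · intro h0 h1
    exact h0 (h1 ▸ Set.mem_univ _)

theorem exists_maximal {F : Set A} (h : IsFilter F) (h0 : (0 : A) ∉ F) :
    ∃ M : Set A, IsMaximalFilter M ∧ F ⊆ M := by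
  obtain ⟨M, hFM, hM⟩ := zorn_subset_nonempty {G : Set A | IsFilter G ∧ (0 : A) ∉ G} (by
    intro c hc hch hne
    refine ⟨⋃₀ c, ⟨⟨?_, ?_, ?_⟩, ?_⟩, fun s hs => Set.subset_sUnion_of_mem hs⟩
    · obtain ⟨G, hG⟩ := hne
      exact ⟨1, G, hG, (hc hG).1.one_mem⟩
    · rintro a ⟨G, hG, ha⟩ b ⟨H, hH, hb⟩
      rcases hch.total hG hH with hs | hs
      · exact ⟨H, hH, (hc hH).1.2.1 _ (hs ha) _ hb⟩
      · exact ⟨G, hG, (hc hG).1.2.1 _ ha _ (hs hb)⟩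
    · rintro a ⟨G, hG, ha⟩ b hab
      exact ⟨G, hG, (hc hG).1.2.2 _ ha _ hab⟩
    · rintro ⟨G, hG, ha⟩
      exact (hc hG).2 ha) F ⟨h, h0⟩
  refine ⟨M, ⟨hM.prop.1, hM.prop.1.ne_univ_iff.2 hM.prop.2, ?_⟩, hFM⟩
  intro G hG hGu hMG
  exact hMG.antisymm (hM.le_of_ge ⟨hG, hG.ne_univ_iff.1 hGu⟩ hMG)

/-- If `u ⊔ v = 1` and `v` lies in no maximal filter then `u = 1`. -/
theorem eq_one_of_sup {u v : A} (h : v ⊔ u = 1)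
    (hv : ∀ M : Set A, IsMaximalFilter M → v ∉ M) : u = 1 := by
  by_contra hu
  obtain ⟨M, hM, hFM⟩ := exists_maximal (coprime_filter u) (by
    intro (h0 : 0 ⊔ u = 1)
    rw [sup_eq_right.2 (zero_le u)] at h0
    exact hu h0)
  exact hv M hM (hFM h)

theorem himp_mul_eq (x y z : A) : himp (x * y) z = himp x (himp y z) := by
  apply le_antisymm
  · rw [← mul_le_iff_himp, ← mul_le_iff_himp, mul_assoc]; exact p_himp_mul _ _
  · rw [← mul_le_iff_himp, ← mul_assoc, mul_le_iff_himp]; exact p_himp_mul _ _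

theorem rimp_mul_eq (x y z : A) : rimp (x * y) z = rimp y (rimp x z) := by
  apply le_antisymm
  · rw [← mul_le_iff_rimp, ← mul_le_iff_rimp, ← mul_assoc]; exact p_mul_rimp _ _
  · rw [← mul_le_iff_rimp, mul_assoc, mul_le_iff_rimp]; exact p_mul_rimp _ _

/-- Main local fact: modulo a normal maximal filter the algebra is commutative. -/
theorem local_fact {M : Set A} (hM : IsMaximalFilter M) (hN : IsNormalFilter M)
    (x y : A) (n : ℕ) :
    lneg (lneg (rimp x y ^ n) * himp x y ^ n) ∈ M := by
  obtain ⟨hF, hu, hmax⟩ := hM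
  have h0 : (0 : A) ∉ M := hF.ne_univ_iff.1 hu
  let L : A → A → Prop := fun x y => himp x y ∈ M
  have hle : ∀ x y : A, x ≤ y → L x y := by
    intro x y h
    show himp x y ∈ M
    rw [p_himp_eq_one h]
    exact hF.one_mem
  have hr : ∀ x, L x x := fun x => hle x x le_rfl
  have ht : ∀ x y z, L x y → L y z → L x z := by
    intro x y z hxy hyz
    refine hF.2.2 _ (hF.2.1 _ hyz _ hxy) _ ?_
    rw [← mul_le_iff_himp, mul_assoc]
    exact (p_mul_left _ (p_himp_mul _ _)).trans (p_himp_mul _ _)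
  have hrm : ∀ x y z, L x y → L (x * z) (y * z) := by
    intro x y z h
    refine hF.2.2 _ h _ ?_
    rw [← mul_le_iff_himp, ← mul_assoc]
    exact p_mul_right _ (p_himp_mul _ _)
  have hl : ∀ x y z, L x y → L (z * x) (z * y) := by
    intro x y z h
    apply (hN _ _).2
    refine hF.2.2 _ ((hN _ _).1 h) _ ?_
    rw [← mul_le_iff_rimp, mul_assoc]
    exact p_mul_left _ (p_mul_rimp _ _)
  have h1 : ∀ x, L x 1 := fun x => hle x 1 (le_one x)
  have hone : ∀ x, L 1 x ↔ x ∈ M := by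
    intro x
    have : himp 1 x = x := by
      apply le_antisymm
      · simpa using p_himp_mul 1 x
      · rw [← mul_le_iff_himp, mul_one]
    show himp 1 x ∈ M ↔ _
    rw [this]
  have hm : ∀ a b c d, L a b → L c d → L (a * c) (b * d) := fun a b c d h h' =>
    ht _ _ _ (hrm _ _ c h) (hl _ _ b h')
  have hnil0 : ∀ x, x ∉ M → ∃ k : ℕ, L (x ^ k) 0 := by
    intro x hx
    by_contra hcon
    have hG : IsFilter {g : A | ∃ k : ℕ, L (x ^ k) g} := by
      refine ⟨⟨1, 0, h1 _⟩, ?_, ?_⟩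
      · rintro a ⟨k, hk⟩ b ⟨l, hl'⟩
        exact ⟨k + l, by rw [pow_add]; exact hm _ _ _ _ hk hl'⟩
      · rintro a ⟨k, hk⟩ b hab
        exact ⟨k, ht _ _ _ hk (hle _ _ hab)⟩
    have := hmax _ hG (hG.ne_univ_iff.2 hcon) (by
      intro g hg
      exact ⟨0, by rw [pow_zero]; exact (hone g).2 hg⟩)
    apply hx
    rw [this]
    exact ⟨1, by rw [pow_one]; exact hr x⟩
  have htot : ∀ x y, L x y ∨ L y x := by
    intro x y
    by_contra hcon
    push Not at hcon
    obtain ⟨k, hk⟩ := hnil0 (himp x y) hcon.1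
    obtain ⟨l, hl'⟩ := hnil0 (himp y x) hcon.2
    have e1 : himp x y ^ k ⊔ himp y x = 1 :=
      (coprime_filter (himp y x)).pow_mem (prelin_himp x y) k
    have e2 : himp y x ^ l ⊔ himp x y ^ k = 1 := by
      refine (coprime_filter (himp x y ^ k)).pow_mem ?_ l
      show _ ⊔ _ = _
      rw [sup_comm]; exact e1
    apply h0
    refine hF.2.2 _ (hF.2.1 _ hk _ hl') _ ?_
    calc himp (himp x y ^ k) 0 * himp (himp y x ^ l) 0
        = (himp (himp x y ^ k) 0 * himp (himp y x ^ l) 0) * (himp y x ^ l ⊔ himp x y ^ k) := by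
          rw [e2, mul_one]
      _ ≤ 0 := by
        apply p_mul_sup_le
        · exact (p_mul_right _ (p_mul_le_right _ _)).trans (p_himp_mul _ _)
        · exact (p_mul_right _ (p_mul_le_left _ _)).trans (p_himp_mul _ _)
  have hres : ∀ x y z, L (x * y) z ↔ L y (rimp x z) := by
    intro x y z
    show himp _ _ ∈ M ↔ himp _ _ ∈ M
    rw [hN, hN, rimp_mul_eq]
  have hdiv : ∀ x y, L x y → ∃ r, L x (y * r) ∧ L (y * r) x := by
    intro x y h
    refine ⟨rimp y x, ?_, hle _ _ (p_mul_rimp _ _)⟩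
    rw [mul_rimp_inf, ← himp_mul_inf]
    have := hrm _ _ x ((hone _).2 h)
    rwa [one_mul] at this
  have hcomm := aux_comm hr ht htot hl hrm h1 hdiv rimp hres (by
    intro x hx
    obtain ⟨k, hk⟩ := hnil0 x (fun h => hx ((hone x).2 h))
    exact ⟨k, fun y => ht _ _ _ hk (hle _ _ (zero_le y))⟩)
  have hba : L (himp x y) (rimp x y) := by
    rw [← hres]
    exact ht _ _ _ (hcomm _ _) (hle _ _ (p_himp_mul _ _))
  exact ht _ _ _ (hl _ _ _ (aux_pow_mono hr ht hl hrm _ _ hba n)) (hle _ _ (p_himp_mul _ _))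

end Basic

end PseudoBL

/-- In a nontrivial pseudo BL-algebra where every maximal filter is
normal, `(((x⇝y)ⁿ)⁻)² ≤ ((x→y)^{2n})⁻` for every `n ≥ 1`. -/
theorem stmt_3 {A : Type*} [PseudoBL A] (hnt : (0 : A) ≠ 1)
    (hnorm : ∀ F : Set A, IsMaximalFilter F → IsNormalFilter F)
    (n : ℕ) (hn : 1 ≤ n) (x y : A) :
    lneg (PseudoBL.rimp x y ^ n) ^ 2 ≤ lneg (PseudoBL.himp x y ^ (2 * n)) := by
  have hloc : ∀ M : Set A, IsMaximalFilter M →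
      lneg (lneg (rimp x y ^ n) * PseudoBL.himp x y ^ n) ∈ M := fun M hM =>
    local_fact hM (hnorm M hM) x y n
  rw [mul_comm 2 n, pow_mul]
  generalize lneg (rimp x y ^ n) = d at *
  generalize PseudoBL.himp x y ^ n = e at *
  unfold lneg at *
  generalize hz : d * e = z at *
  rw [← mul_le_iff_himp]
  have hzz : d ^ 2 * e ^ 2 = d * z * e := by
    rw [← hz]; simp only [pow_two, mul_assoc]
  rw [hzz]
  have key : PseudoBL.himp (d * z) (PseudoBL.himp e 0) ⊔ PseudoBL.himp d (PseudoBL.himp z 0) = 1 := by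
    have hF := coprime_filter (PseudoBL.himp (d * z) (PseudoBL.himp e 0) ⊔ PseudoBL.himp d (PseudoBL.himp z 0))
    have h1 := hF.2.1 (PseudoBL.himp (PseudoBL.himp z 0) d) (by
      apply le_antisymm (le_one _)
      rw [← prelin_himp (PseudoBL.himp z 0) d]
      exact sup_le_sup_left le_sup_right _) (PseudoBL.himp (PseudoBL.himp e 0) (d * z)) (by
      apply le_antisymm (le_one _)
      rw [← prelin_himp (PseudoBL.himp e 0) (d * z)]
      exact sup_le_sup_left le_sup_left _)
    refine eq_one_of_sup h1 ?_
    intro M hM hmem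
    have hMF := hM.1
    have h0 : (0 : A) ∉ M := hMF.ne_univ_iff.1 hM.2.1
    have hzM := hloc M hM
    have hp := hMF.2.2 _ hmem _ (p_mul_le_left _ _)
    have hq := hMF.2.2 _ hmem _ (p_mul_le_right _ _)
    have hd : d ∈ M := hMF.2.2 _ (hMF.2.1 _ hp _ hzM) _ (p_himp_mul _ _)
    have he : PseudoBL.himp e 0 ∈ M := by
      refine hMF.2.2 _ (hMF.2.1 _ hzM _ hd) _ ?_
      rw [← mul_le_iff_himp, mul_assoc, hz]
      exact p_himp_mul _ _
    have hdz : d * z ∈ M := hMF.2.2 _ (hMF.2.1 _ hq _ he) _ (p_himp_mul _ _)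
    have hz' : z ∈ M := hMF.2.2 _ hdz _ (p_mul_le_right _ _)
    exact h0 (hMF.2.2 _ (hMF.2.1 _ hzM _ hz') _ (p_himp_mul _ _))
  rw [← one_mul (d * z * e), ← key]
  apply p_sup_mul_le
  · rw [← mul_assoc]
    exact (p_mul_right _ (p_himp_mul _ _)).trans (p_himp_mul _ _)
  · rw [← mul_assoc, ← mul_assoc]
    refine (p_mul_le_left _ _).trans ?_
    exact (p_mul_right _ (p_himp_mul _ _)).trans (p_himp_mul _ _)
end

section
/- Let (A, u) be a unital basic pseudo hoop. Then every maximal filter of A is normal if, and only if, A satisfies, for all n ≥ 1, all elements and all permutations π of {1, …, n}, the inequalities: (i) ((x₁·⋯·xₙ)→u)² ≤ (x_{π(1)}²·⋯·x_{π(n)}²)→u; (ii) (((x→y)ⁿ)→u)² ≤ ((x⇝y)^{2n})→u; (iii) (((x⇝y)ⁿ)→u)² ≤ ((x→y)^{2n})→u. -/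
/-- A pseudo hoop: a monoid `(A; ·, 1)` with two implications `→` (`himp`) and
`⇝` (`rimp`) satisfying the pseudo-hoop identities, where the induced order
`x ≤ y ↔ x→y = 1 ↔ x⇝y = 1` is the given partial order. -/
class PseudoHoop (A : Type*) extends Monoid A, PartialOrder A where
  himp : A → A → A
  rimp : A → A → A
  himp_self : ∀ x : A, himp x x = 1
  rimp_self : ∀ x : A, rimp x x = 1
  himp_mul : ∀ x y z : A, himp (x * y) z = himp x (himp y z)
  rimp_mul : ∀ x y z : A, rimp (x * y) z = rimp y (rimp x z)
  div₁ : ∀ x y : A, himp x y * x = himp y x * y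
  div₂ : ∀ x y : A, himp x y * x = x * rimp x y
  div₃ : ∀ x y : A, x * rimp x y = y * rimp y x
  le_iff_himp : ∀ x y : A, x ≤ y ↔ himp x y = 1
  le_iff_rimp : ∀ x y : A, x ≤ y ↔ rimp x y = 1

/-- A basic pseudo hoop: a pseudo hoop satisfying (B1) and (B2). -/
class BasicPseudoHoop (A : Type*) extends PseudoHoop A where
  basic₁ : ∀ x y z : A,
    himp (himp x y) z ≤ himp (himp (himp y x) z) z
  basic₂ : ∀ x y z : A,
    rimp (rimp x y) z ≤ rimp (rimp (rimp y x) z) z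

namespace PseudoHoop

variable {A : Type*} [PseudoHoop A]

/-- A filter: a nonempty subset closed under `·` and upward closed. -/
def IsFilter (F : Set A) : Prop :=
  F.Nonempty ∧ (∀ x ∈ F, ∀ y ∈ F, x * y ∈ F) ∧ ∀ x ∈ F, ∀ y : A, x ≤ y → y ∈ F

/-- A maximal filter: a proper filter not properly contained in any proper filter. -/
def IsMaximalFilter (F : Set A) : Prop :=
  IsFilter F ∧ F ≠ Set.univ ∧
    ∀ G : Set A, IsFilter G → G ≠ Set.univ → F ⊆ G → F = G

/-- A normal filter: `x→y ∈ F` iff `x⇝y ∈ F`. -/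
def IsNormalFilter (F : Set A) : Prop :=
  ∀ x y : A, himp x y ∈ F ↔ rimp x y ∈ F

/-- The filter generated by an element `a`: all `x` with `aᵏ ≤ x` for some `k ≥ 1`. -/
def genFilter (a : A) : Set A := {x : A | ∃ k : ℕ, 1 ≤ k ∧ a ^ k ≤ x}

/-- A strong unit: an element generating the whole pseudo hoop as a filter. -/
def IsStrongUnit (u : A) : Prop := genFilter u = Set.univ

end PseudoHoop

open PseudoHoop


namespace PseudoHoop

section basics
variable {A : Type*} [PseudoHoop A]

theorem le_himp {x y z : A} : z ≤ himp x y ↔ z * x ≤ y := by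
  rw [le_iff_himp, le_iff_himp, himp_mul]

theorem le_rimp {x y z : A} : z ≤ rimp x y ↔ x * z ≤ y := by
  rw [le_iff_rimp, le_iff_rimp, rimp_mul]

theorem one_himp' (x : A) : himp 1 x = x := by
  apply le_antisymm
  · have h := (le_himp (x := (1 : A)) (y := x) (z := himp 1 x)).1 le_rfl
    rwa [mul_one] at h
  · rw [le_himp, mul_one]

theorem himp_one' (x : A) : himp x 1 = 1 := by
  have h := div₁ x 1
  rw [one_himp', mul_one] at h
  have h2 := himp_mul (himp x 1) x 1
  rw [h, himp_self] at h2
  exact h2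

theorem le_one'' (x : A) : x ≤ 1 := by rw [le_iff_himp, himp_one']

theorem mulr {x y : A} (z : A) (h : x ≤ y) : x * z ≤ y * z :=
  le_himp.1 (h.trans (le_himp.2 le_rfl))

theorem mull {x y : A} (z : A) (h : x ≤ y) : z * x ≤ z * y :=
  le_rimp.1 (h.trans (le_rimp.2 le_rfl))

theorem mul_le_r (x y : A) : x * y ≤ y := by simpa using mulr y (le_one'' x)
theorem mul_le_l (x y : A) : x * y ≤ x := by simpa using mull x (le_one'' y)

theorem himp_app (x y : A) : himp x y * x ≤ y := le_himp.1 le_rfl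
theorem rimp_app (x y : A) : x * rimp x y ≤ y := le_rimp.1 le_rfl

variable {F : Set A}

theorem one_mem' (hF : IsFilter F) : (1 : A) ∈ F := by
  obtain ⟨x, hx⟩ := hF.1
  exact hF.2.2 x hx 1 (le_one'' x)

theorem pow_mem' (hF : IsFilter F) {x : A} (hx : x ∈ F) (k : ℕ) : x ^ k ∈ F := by
  induction k with
  | zero => simpa using one_mem' hF
  | succ k ih => rw [pow_succ]; exact hF.2.1 _ ih _ hx

theorem mem_iff (hF : IsFilter F) {x y : A} : himp x y ∈ F ↔ ∃ p ∈ F, p * x ≤ y :=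
  ⟨fun h => ⟨_, h, himp_app x y⟩, fun ⟨p, hp, h⟩ => hF.2.2 p hp _ (le_himp.2 h)⟩

theorem lem_of_le (hF : IsFilter F) {x y : A} (h : x ≤ y) : himp x y ∈ F := by
  rw [(le_iff_himp x y).1 h]; exact one_mem' hF

theorem lem_trans (hF : IsFilter F) {x y z : A} (h : himp x y ∈ F) (h' : himp y z ∈ F) :
    himp x z ∈ F := by
  refine (mem_iff hF).2 ⟨_, hF.2.1 _ h' _ h, ?_⟩
  rw [mul_assoc]
  exact (mull _ (himp_app x y)).trans (himp_app y z)

theorem lem_mulr (hF : IsFilter F) {x y : A} (z : A) (h : himp x y ∈ F) :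
    himp (x * z) (y * z) ∈ F := by
  refine (mem_iff hF).2 ⟨_, h, ?_⟩
  rw [← mul_assoc]
  exact mulr z (himp_app x y)

theorem lem_mull (hF : IsFilter F) (hn : IsNormalFilter F) {x y : A} (z : A) (h : himp x y ∈ F) :
    himp (z * x) (z * y) ∈ F := by
  rw [hn] at h ⊢
  refine hF.2.2 _ h _ (le_rimp.2 ?_)
  rw [mul_assoc]
  exact mull z (rimp_app x y)

theorem lem_mem (hF : IsFilter F) {x y : A} (hx : x ∈ F) (h : himp x y ∈ F) : y ∈ F :=
  hF.2.2 _ (hF.2.1 _ h _ hx) _ (himp_app x y)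

/-- Zorn: extend a filter avoiding `c` to a maximal one. -/
theorem exists_max (hF : IsFilter F) {c : A} (hc : c ∉ F) :
    ∃ M : Set A, IsFilter M ∧ F ⊆ M ∧ c ∉ M ∧
      ∀ G : Set A, IsFilter G → M ⊆ G → c ∉ G → G = M := by
  obtain ⟨M, hFM, hM⟩ := zorn_subset_nonempty {G : Set A | IsFilter G ∧ c ∉ G} (by
    intro C hC hch hne
    refine ⟨⋃₀ C, ⟨⟨?_, ?_, ?_⟩, ?_⟩, fun s hs => Set.subset_sUnion_of_mem hs⟩
    · obtain ⟨G, hG⟩ := hne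
      obtain ⟨x, hx⟩ := (hC hG).1.1
      exact ⟨x, G, hG, hx⟩
    · rintro x ⟨G, hG, hx⟩ y ⟨H, hH, hy⟩
      rcases hch.total hG hH with h | h
      · exact ⟨H, hH, (hC hH).1.2.1 _ (h hx) _ hy⟩
      · exact ⟨G, hG, (hC hG).1.2.1 _ hx _ (h hy)⟩
    · rintro x ⟨G, hG, hx⟩ y hxy
      exact ⟨G, hG, (hC hG).1.2.2 _ hx _ hxy⟩
    · rintro ⟨G, hG, hx⟩
      exact (hC hG).2 hx) F ⟨hF, hc⟩
  refine ⟨M, hM.prop.1, hFM, hM.prop.2, fun G hG hMG hcG => ?_⟩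
  exact (hM.eq_of_subset ⟨hG, hcG⟩ hMG).symm

theorem univ_of_unit {u : A} (hu : IsStrongUnit u) (hF : IsFilter F) (h : u ∈ F) :
    F = Set.univ := by
  ext x
  simp only [Set.mem_univ, iff_true]
  have hx : x ∈ genFilter u := by rw [hu]; trivial
  obtain ⟨k, _, hk⟩ := hx
  exact hF.2.2 _ (pow_mem' hF h k) _ hk

/-- `{s : s ∨ t ∈ P}` -/
def joinSet (P : Set A) (t : A) : Set A := {s | ∀ z, s ≤ z → t ≤ z → z ∈ P}

theorem joinSet_filter {P : Set A} (hP : IsFilter P) (t : A) :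
    IsFilter (joinSet P t) ∧ P ⊆ joinSet P t := by
  have hsub : P ⊆ joinSet P t := fun p hp z hz _ => hP.2.2 p hp z hz
  refine ⟨⟨⟨1, hsub (one_mem' hP)⟩, ?_, ?_⟩, hsub⟩
  · intro s hs s' hs' z hz htz
    have h1 : himp s' z ∈ P :=
      hs _ (le_himp.2 hz) (htz.trans (le_himp.2 (mul_le_l _ _)))
    have h2 : rimp (himp s' z) z ∈ P :=
      hs' _ (le_rimp.2 (himp_app _ _)) (htz.trans (le_rimp.2 (mul_le_r _ _)))
    exact hP.2.2 _ (hP.2.1 _ h1 _ h2) _ (rimp_app _ _)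
  · intro s hs y hsy z hz htz
    exact hs z (hsy.trans hz) htz

/-- archimedean property of maximal normal filters -/
theorem arch {V : Set A} (hV : IsMaximalFilter V) (hn : IsNormalFilter V) {g : A} (hg : g ∉ V)
    (w : A) : ∃ h ∈ V, ∃ k : ℕ, h * g ^ k ≤ w := by
  obtain ⟨hF, hne, hmax⟩ := hV
  let G : Set A := {w | ∃ h ∈ V, ∃ k : ℕ, h * g ^ k ≤ w}
  have hG : IsFilter G := by
    refine ⟨⟨1, 1, one_mem' hF, 0, le_one'' _⟩, ?_, ?_⟩
    · rintro x ⟨h, hh, k, hk⟩ y ⟨h', hh', k', hk'⟩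
      have h1 : himp (g ^ k) (g ^ k * h') ∈ V := by
        rw [hn]
        exact hF.2.2 _ hh' _ (le_rimp.2 le_rfl)
      refine ⟨h * himp (g ^ k) (g ^ k * h'), hF.2.1 _ hh _ h1, k + k', ?_⟩
      calc h * himp (g ^ k) (g ^ k * h') * g ^ (k + k')
          = h * (himp (g ^ k) (g ^ k * h') * g ^ k) * g ^ k' := by
            rw [pow_add]; simp only [mul_assoc]
        _ ≤ h * (g ^ k * h') * g ^ k' := mulr _ (mull _ (himp_app _ _))
        _ = (h * g ^ k) * (h' * g ^ k') := by simp only [mul_assoc]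
        _ ≤ x * (h' * g ^ k') := mulr _ hk
        _ ≤ x * y := mull _ hk'
    · rintro x ⟨h, hh, k, hk⟩ y hxy
      exact ⟨h, hh, k, hk.trans hxy⟩
  have hVG : V ⊆ G := fun h hh => ⟨h, hh, 0, by simp⟩
  have hgG : g ∈ G := ⟨1, one_mem' hF, 1, by simp⟩
  by_contra hcon
  have hGne : G ≠ Set.univ := by
    intro h
    have : w ∈ G := by rw [h]; trivial
    exact hcon this
  have := hmax G hG hGne hVG
  exact hg (this ▸ hgG)

end basics

section basic
variable {A : Type*} [BasicPseudoHoop A]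

theorem prelin {x y z : A} (h1 : himp x y ≤ z) (h2 : himp y x ≤ z) : z = 1 := by
  have h := BasicPseudoHoop.basic₁ x y z
  rw [(le_iff_himp _ _).1 h1, (le_iff_himp _ _).1 h2, one_himp'] at h
  exact le_antisymm (le_one'' _) h

def Tot (P : Set A) : Prop := ∀ x y : A, himp x y ∈ P ∨ himp y x ∈ P

theorem exists_prime {c : A} (hc : c ≠ 1) : ∃ P : Set A, IsFilter P ∧ Tot P ∧ c ∉ P := by
  have h1 : IsFilter ({1} : Set A) := by
    refine ⟨⟨1, rfl⟩, ?_, ?_⟩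
    · rintro x rfl y rfl
      simp
    · rintro x rfl y hy
      exact le_antisymm (le_one'' _) hy
  obtain ⟨P, hP, -, hcP, hmax⟩ := exists_max h1 (c := c) (by simpa using hc)
  refine ⟨P, hP, ?_, hcP⟩
  intro x y
  by_contra! hcon
  obtain ⟨ha, hb⟩ := hcon
  have h2 : c ∈ joinSet P (himp y x) := by
    by_contra hcc
    have h := hmax _ (joinSet_filter hP _).1 (joinSet_filter hP (himp y x)).2 hcc
    apply ha
    rw [← h]
    intro z hz1 hz2
    rw [prelin hz1 hz2]
    exact one_mem' hP
  have h3 : c ∈ joinSet P c := by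
    by_contra hcc
    have h := hmax _ (joinSet_filter hP _).1 (joinSet_filter hP c).2 hcc
    apply hb
    rw [← h]
    intro z hz1 hz2
    exact h2 z hz2 hz1
  exact hcP (h3 c le_rfl le_rfl)

variable {P V : Set A}

theorem lemM (hP : IsFilter P) (hT : Tot P) (hPV : P ⊆ V) (hV : IsMaximalFilter V)
    (hn : IsNormalFilter V) {g : A} (hg : g ∉ V) (w : A) : ∃ k : ℕ, himp (g ^ k) w ∈ P := by
  obtain ⟨h, hh, k, hk⟩ := arch hV hn hg w
  refine ⟨k + 1, ?_⟩
  have h1 : himp g h ∈ P := by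
    rcases hT g h with h1 | h1
    · exact h1
    · exact absurd (lem_mem hV.1 hh (hPV h1)) hg
  rw [pow_succ']
  exact lem_trans hP (lem_mulr hP _ h1) (lem_of_le hP hk)

theorem lemL (hP : IsFilter P) (hT : Tot P) (hPV : P ⊆ V) (hV : IsMaximalFilter V)
    (hn : IsNormalFilter V) {Y e f u : A} (hf : Y * f ≤ u) (hfe : himp f e ∉ V) :
    himp (Y * e) u ∈ P := by
  have key : himp Y (Y * himp e f) ∈ P ∨ himp Y (Y * himp f e) ∈ P := by
    have aux : ∀ a b c : A, himp (Y * himp a b) c ∈ P → Y * himp b a ≤ c → himp Y c ∈ P := by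
      intro a b c h h'
      refine (mem_iff hP).2 ⟨_, h, ?_⟩
      have h1 : himp a b ≤ rimp (himp (Y * himp a b) c * Y) c := by
        rw [le_rimp, mul_assoc]
        exact himp_app _ _
      have h2 : himp b a ≤ rimp (himp (Y * himp a b) c * Y) c := by
        rw [le_rimp, mul_assoc]
        exact (mul_le_r _ _).trans h'
      exact (le_iff_rimp _ _).2 (prelin h1 h2)
    rcases hT (Y * himp e f) (Y * himp f e) with h | h
    · exact Or.inr (aux _ _ _ h le_rfl)
    · exact Or.inl (aux _ _ _ h le_rfl)
  rcases key with h | h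
  · refine lem_trans hP (lem_mulr hP e h) (lem_of_le hP ?_)
    rw [mul_assoc]
    exact (mull _ (himp_app _ _)).trans hf
  · obtain ⟨k, hk⟩ := lemM hP hT hPV hV hn hfe u
    have hY : ∀ j : ℕ, himp Y (Y * himp f e ^ j) ∈ P := by
      intro j
      induction j with
      | zero => exact lem_of_le hP (by simp)
      | succ j ih =>
        rw [pow_succ', ← mul_assoc]
        exact lem_trans hP ih (lem_mulr hP _ h)
    exact lem_trans hP (lem_of_le hP (mul_le_l _ _))
      (lem_trans hP (hY k) (lem_trans hP (lem_of_le hP (mul_le_r _ _)) hk))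

/-- special case: `Y ≤ u` modulo `V` and `e ∉ V`. -/
theorem lemL' (hP : IsFilter P) (hT : Tot P) (hPV : P ⊆ V) (hV : IsMaximalFilter V)
    (hn : IsNormalFilter V) {Y e u : A} (hf : himp Y u ∈ V) (he : e ∉ V) :
    himp (Y * e) u ∈ P := by
  rw [hn] at hf
  exact lemL hP hT hPV hV hn (rimp_app Y u) (fun h => he (lem_mem hV.1 hf h))

theorem arch' (hV : IsMaximalFilter V) (hn : IsNormalFilter V) {g : A} (hg : g ∉ V)
    (w : A) : ∃ k : ℕ, himp (g ^ k) w ∈ V := by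
  obtain ⟨h, hh, k, hk⟩ := arch hV hn hg w
  exact ⟨k, (mem_iff hV.1).2 ⟨h, hh, hk⟩⟩

theorem listCase (hP : IsFilter P) (hT : Tot P) (hPV : P ⊆ V) (hV : IsMaximalFilter V)
    (hn : IsNormalFilter V) {u : A} (l : List A) : ∀ Y T : A, himp Y T ∈ V →
      himp (T * l.prod) u ∈ V → himp T u ∉ V → himp (Y * (l.map (· ^ 2)).prod) u ∈ P := by
  induction l with
  | nil =>
    intro Y T _ h1 h2
    simp at h1
    exact absurd h1 h2
  | cons x l ih =>
    intro Y T hYT h1 h2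
    rw [List.prod_cons, ← mul_assoc] at h1
    rw [List.map_cons, List.prod_cons, ← mul_assoc]
    by_cases hx : himp (T * x) u ∈ V
    · have hxV : x ∉ V := by
        intro hxV
        apply h2
        rw [hn] at hx ⊢
        refine hV.1.2.2 _ (hV.1.2.1 _ hxV _ hx) _ (le_rimp.2 ?_)
        rw [← mul_assoc]
        exact rimp_app _ _
      have h3 := lemL' hP hT hPV hV hn (lem_trans hV.1 (lem_mulr hV.1 x hYT) hx) hxV
      rw [mul_assoc, ← pow_two] at h3
      exact lem_trans hP (lem_of_le hP (mul_le_l _ _)) h3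
    · refine ih (Y * x ^ 2) (T * x) ?_ h1 hx
      refine lem_trans hV.1 (lem_of_le hV.1 ?_) (lem_mulr hV.1 x hYT)
      rw [pow_two]
      exact mull _ (mul_le_l _ _)

theorem prod_sq_le (l : List A) : (l.map (· ^ 2)).prod ≤ l.prod := by
  induction l with
  | nil => simp
  | cons x l ih =>
    rw [List.map_cons, List.prod_cons, List.prod_cons]
    refine (mull _ ih).trans (mulr _ ?_)
    rw [pow_two]
    exact mul_le_l _ _

theorem main_ineq {u : A} (hu : IsStrongUnit u)
    (H : ∀ F : Set A, IsMaximalFilter F → IsNormalFilter F) (X : A) (l : List A)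
    (hX : ∀ V : Set A, IsMaximalFilter V → IsNormalFilter V → Tot V → himp l.prod X ∈ V) :
    himp X u ^ 2 ≤ himp (l.map (· ^ 2)).prod u := by
  rw [le_iff_himp]
  by_contra hc
  obtain ⟨P, hP, hT, hcP⟩ := exists_prime hc
  have huP : u ∉ P := by
    intro h
    rw [univ_of_unit hu hP h] at hcP
    exact hcP trivial
  obtain ⟨V, hVF, hPV, huV, hmax⟩ := exists_max hP huP
  have hV : IsMaximalFilter V := by
    refine ⟨hVF, fun h => huV (by rw [h]; trivial), fun G hG hGne hVG => ?_⟩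
    exact (hmax G hG hVG (fun h => hGne (univ_of_unit hu hG h))).symm
  have hn := H V hV
  have hTV : Tot V := fun x y => (hT x y).imp (fun h => hPV h) (fun h => hPV h)
  have hl := hX V hV hn hTV
  set a := himp X u with ha
  set X' := (l.map (· ^ 2)).prod with hX'
  have haX : a * X ≤ u := himp_app X u
  have hcP' : himp (a ^ 2 * X') u ∉ P := by rwa [himp_mul]
  -- case A
  have hXV : X ∉ V := by
    intro hXV
    have h1 : himp a u ∈ V := by
      rw [hn]
      exact hVF.2.2 _ hXV _ (le_rimp.2 haX)
    have h2 : a ∉ V := fun h => huV (lem_mem hVF h h1)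
    have h3 := lemL' hP hT hPV hV hn h1 h2
    rw [← pow_two] at h3
    exact hcP' (lem_trans hP (lem_of_le hP (mul_le_l _ _)) h3)
  -- case B
  have hXu : a ∉ V := by
    intro hXu
    have h1 := listCase hP hT hPV hV hn (u := u) l 1 1 (lem_of_le hVF le_rfl)
      (by rw [one_mul]; exact lem_trans hVF hl hXu) (by rwa [one_himp'])
    rw [one_mul] at h1
    exact hcP' (lem_trans hP (lem_of_le hP (mul_le_r _ _)) h1)
  have hb : himp (himp X' u) (a ^ 2) ∈ V := by
    rcases hT (a ^ 2) (himp X' u) with h | h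
    · exact absurd h hcP
    · exact hPV h
  have hab : himp a (himp X' u) ∈ V := by
    rw [← himp_mul]
    refine lem_trans hVF (lem_mull hVF hn a ?_) (lem_of_le hVF haX)
    exact lem_trans hVF (lem_of_le hVF (prod_sq_le l)) hl
  have haa : himp a (a ^ 2) ∈ V := lem_trans hVF hab hb
  have hak : ∀ k : ℕ, himp a (a ^ (k + 1)) ∈ V := by
    intro k
    induction k with
    | zero => exact lem_of_le hVF (by simp)
    | succ k ih =>
      refine lem_trans hVF haa ?_
      rw [pow_two, pow_succ a (k + 1)]
      exact lem_mulr hVF a ih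
  have hau : himp a u ∈ V := by
    obtain ⟨k, hk⟩ := arch' hV hn hXu u
    refine lem_trans hVF (hak k) (lem_trans hVF (lem_of_le hVF ?_) hk)
    rw [pow_succ]
    exact mul_le_l _ _
  have hdesc : ∀ k : ℕ, himp (X ^ k) u ∈ V → False := by
    intro k
    induction k with
    | zero =>
      intro h
      rw [pow_zero, one_himp'] at h
      exact huV h
    | succ k ih =>
      intro h
      rw [pow_succ, himp_mul] at h
      exact ih (lem_trans hVF h hau)
  obtain ⟨k, hk⟩ := arch' hV hn hXV u
  exact hdesc k hk

/-! Commutativity modulo a maximal normal filter. -/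

theorem pow_anti (x : A) {m n : ℕ} (h : m ≤ n) : x ^ n ≤ x ^ m := by
  obtain ⟨k, rfl⟩ := Nat.exists_eq_add_of_le h
  rw [pow_add]
  exact mul_le_l _ _

theorem bracket (hV : IsMaximalFilter V) (hn : IsNormalFilter V) (hT : Tot V) {d : A}
    (hd : d ∉ V) (x : A) : ∃ k : ℕ, himp (d ^ (k + 1)) x ∈ V ∧ himp x (d ^ k) ∈ V := by
  classical
  have hex : ∃ k : ℕ, himp (d ^ (k + 1)) x ∈ V := by
    obtain ⟨k, hk⟩ := arch' hV hn hd x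
    exact ⟨k, lem_trans hV.1 (lem_of_le hV.1 (pow_anti d (Nat.le_succ k))) hk⟩
  refine ⟨Nat.find hex, Nat.find_spec hex, ?_⟩
  rcases hk : Nat.find hex with _ | k
  · rw [pow_zero]
    exact lem_of_le hV.1 (le_one'' _)
  · have := Nat.find_min hex (m := k) (by omega)
    exact (hT x (d ^ (k + 1))).resolve_right this

theorem comm_mod (hV : IsMaximalFilter V) (hn : IsNormalFilter V) (hT : Tot V) (x y : A) :
    himp (x * y) (y * x) ∈ V := by
  have hF := hV.1
  by_contra hcon
  set e := rimp (x * y) (y * x) with he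
  have heV : e ∉ V := by rwa [he, ← hn]
  by_cases hatom : ∃ e, e ∉ V ∧ ∀ z, z ∉ V → himp z e ∈ V
  · -- every element is equivalent to a power of `e`
    clear heV he e
    obtain ⟨e, heV, hatom⟩ := hatom
    have hpow : ∀ z : A, ∃ k : ℕ, himp z (e ^ k) ∈ V ∧ himp (e ^ k) z ∈ V := by
      intro z
      obtain ⟨k, hk1, hk2⟩ := bracket hV hn hT heV z
      by_cases hw : rimp (e ^ k) z ∈ V
      · exact ⟨k, hk2, by rwa [hn]⟩
      · refine ⟨k + 1, ?_, hk1⟩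
        have h1 := hatom _ hw
        have h2 := lem_mull hF hn (e ^ k) h1
        rw [← pow_succ, ← div₂, div₁, ] at h2
        refine lem_trans hF ((mem_iff hF).2 ⟨_, hk2, le_rfl⟩) h2
    obtain ⟨k, hk1, hk2⟩ := hpow x
    obtain ⟨j, hj1, hj2⟩ := hpow y
    apply hcon
    refine lem_trans hF (lem_mulr hF y hk1) (lem_trans hF (lem_mull hF hn _ hj1) ?_)
    rw [← pow_add, add_comm, pow_add]
    exact lem_trans hF (lem_mulr hF _ hj2) (lem_mull hF hn _ hk2)
  · push Not at hatom
    obtain ⟨z, hzV, hze⟩ := hatom e heV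
    -- z ≤ d^2 with d ∉ V
    obtain ⟨d, hdV, hd⟩ : ∃ d, d ∉ V ∧ himp z (d ^ 2) ∈ V := by
      obtain ⟨s, hsV, hsz⟩ := hatom z hzV
      have hzs : himp z s ∈ V := (hT z s).resolve_right hsz
      set w := rimp s z with hw
      have hwV : w ∉ V := by rwa [hw, ← hn]
      have hzsw : himp z (s * w) ∈ V := by
        rw [hw, ← div₂, div₁]
        exact (mem_iff hF).2 ⟨_, hzs, le_rfl⟩
      rcases hT s w with h | h
      · refine ⟨w, hwV, lem_trans hF hzsw ?_⟩
        rw [pow_two]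
        exact lem_mulr hF _ h
      · refine ⟨s, hsV, lem_trans hF hzsw ?_⟩
        rw [pow_two]
        exact lem_mull hF hn _ h
    obtain ⟨k, hk1, hk2⟩ := bracket hV hn hT hdV x
    obtain ⟨j, hj1, hj2⟩ := bracket hV hn hT hdV y
    have h1 : himp (x * y) (d ^ (k + j)) ∈ V := by
      rw [pow_add]
      exact lem_trans hF (lem_mulr hF y hk2) (lem_mull hF hn _ hj2)
    have h2 : himp (d ^ (k + j + 2)) (y * x) ∈ V := by
      have : k + j + 2 = (j + 1) + (k + 1) := by ring
      rw [this, pow_add]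
      exact lem_trans hF (lem_mulr hF _ hj1) (lem_mull hF hn _ hk1)
    have h3 : himp (x * y * d ^ 2) (y * x) ∈ V := by
      refine lem_trans hF (lem_mulr hF _ h1) ?_
      rwa [← pow_add]
    rw [hn, rimp_mul, ← he, ← hn] at h3
    exact hze (lem_trans hF hd h3)

theorem perm_mod (hV : IsMaximalFilter V) (hn : IsNormalFilter V) (hT : Tot V) {l l' : List A}
    (h : l.Perm l') : himp l.prod l'.prod ∈ V := by
  have hF := hV.1
  induction h with
  | nil => exact lem_of_le hF le_rfl
  | cons x _ ih =>
    rw [List.prod_cons, List.prod_cons]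
    exact lem_mull hF hn _ ih
  | swap x y l =>
    simp only [List.prod_cons, ← mul_assoc]
    exact lem_mulr hF _ (comm_mod hV hn hT _ _)
  | trans _ _ ih1 ih2 => exact lem_trans hF ih1 ih2

theorem rimp_himp_mod (hV : IsMaximalFilter V) (hn : IsNormalFilter V) (hT : Tot V) (x y : A) :
    himp (rimp x y) (himp x y) ∈ V := by
  rw [← himp_mul]
  exact lem_trans hV.1 (comm_mod hV hn hT _ _) (lem_of_le hV.1 (rimp_app x y))

theorem himp_rimp_mod (hV : IsMaximalFilter V) (hn : IsNormalFilter V) (hT : Tot V) (x y : A) :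
    himp (himp x y) (rimp x y) ∈ V := by
  rw [hn, ← rimp_mul, ← hn]
  exact lem_trans hV.1 (comm_mod hV hn hT _ _) (lem_of_le hV.1 (himp_app x y))

theorem pow_mod (hF : IsFilter V) (hn : IsNormalFilter V) {x y : A} (h : himp x y ∈ V) (n : ℕ) :
    himp (x ^ n) (y ^ n) ∈ V := by
  induction n with
  | zero => exact lem_of_le hF (by simp)
  | succ n ih =>
    rw [pow_succ, pow_succ]
    exact lem_trans hF (lem_mulr hF _ ih) (lem_mull hF hn _ h)

theorem main_pow {u : A} (hu : IsStrongUnit u)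
    (H : ∀ F : Set A, IsMaximalFilter F → IsNormalFilter F) (a b : A) (n : ℕ)
    (hX : ∀ V : Set A, IsMaximalFilter V → IsNormalFilter V → Tot V → himp b a ∈ V) :
    himp (a ^ n) u ^ 2 ≤ himp (b ^ (2 * n)) u := by
  have h := main_ineq hu H (a ^ n) (List.replicate n b) (by
    intro V hV hn hT
    rw [List.prod_replicate]
    exact pow_mod hV.1 hn (hX V hV hn hT) n)
  rwa [List.map_replicate, List.prod_replicate, ← pow_mul] at h

theorem exists_perm_of_list {n : ℕ} (I : List (Fin n)) (h : I.Perm (List.finRange n)) :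
    ∃ σ : Equiv.Perm (Fin n), ∀ f : Fin n → A, List.ofFn (fun i => f (σ i)) = I.map f := by
  have hlen : I.length = n := by simpa using h.length_eq
  have hnd : I.Nodup := h.nodup_iff.2 (List.nodup_finRange n)
  have hinj : Function.Injective (fun i : Fin n => I.get (Fin.cast hlen.symm i)) := by
    intro i j hij
    have := (List.nodup_iff_injective_get.1 hnd) hij
    simpa using this
  refine ⟨Equiv.ofBijective _ (Finite.injective_iff_bijective.1 hinj), fun f => ?_⟩
  apply List.ext_getElem
  · simp [hlen]
  · intro i h1 h2
    simp

/-- The converse direction: half of normality. -/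
theorem half {u : A} (hu : IsStrongUnit u)
    (hi : ∀ (n : ℕ), 1 ≤ n → ∀ (x : Fin n → A) (π : Equiv.Perm (Fin n)),
        himp (List.ofFn x).prod u ^ 2 ≤ himp (List.ofFn (fun i => x (π i) ^ 2)).prod u)
    (hV : IsMaximalFilter V) (a b : A) (ha : a ∈ V)
    (hab : ∀ n : ℕ, 1 ≤ n → himp (b ^ n) u ^ 2 ≤ himp (a ^ (2 * n)) u) : b ∈ V := by
  classical
  obtain ⟨hF, hne, hmax⟩ := hV
  by_contra hb
  have huV : u ∉ V := fun h => hne (univ_of_unit hu hF h)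
  let G : Set A := {z | ∃ l : List A, (∀ s ∈ l, s ∈ V ∨ s = b) ∧ l.prod ≤ z}
  have hG : IsFilter G := by
    refine ⟨⟨1, [], by simp, by simp⟩, ?_, ?_⟩
    · rintro x ⟨l, hl, hlx⟩ y ⟨l', hl', hly⟩
      refine ⟨l ++ l', ?_, ?_⟩
      · intro s hs
        rcases List.mem_append.1 hs with h | h
        · exact hl s h
        · exact hl' s h
      · rw [List.prod_append]
        exact (mulr _ hlx).trans (mull _ hly)
    · rintro x ⟨l, hl, hlx⟩ y hxy
      exact ⟨l, hl, hlx.trans hxy⟩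
  have hGu : G = Set.univ := by
    by_contra hGne
    have h := hmax G hG hGne (fun v hv => ⟨[v], by simpa using Or.inl hv, by simp⟩)
    apply hb
    rw [h]
    exact ⟨[b], by simp, by simp⟩
  obtain ⟨l, hl, hlu⟩ : u ∈ G := by rw [hGu]; trivial
  have hlen : 1 ≤ l.length := by
    rcases l with _ | ⟨s, l⟩
    · exfalso
      exact huV (hF.2.2 _ (one_mem' hF) _ (by simpa using hlu))
    · simp
  obtain ⟨l1, l2, σ, hσ, h1, h2⟩ : ∃ (l1 l2 : List A) (σ : Equiv.Perm (Fin l.length)),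
      List.ofFn (fun i => l.get (σ i)) = l1 ++ l2 ∧ (∀ s ∈ l1, s ∈ V) ∧ ∀ s ∈ l2, s = b := by
    obtain ⟨σ, hσ⟩ := exists_perm_of_list (A := A)
      ((List.finRange l.length).filter (fun i => decide (l.get i ∈ V)) ++
        (List.finRange l.length).filter (fun i => !decide (l.get i ∈ V)))
      (List.filter_append_perm (fun i => decide (l.get i ∈ V)) (List.finRange l.length))
    refine ⟨_, _, σ, by rw [hσ l.get, List.map_append], ?_, ?_⟩
    · intro s hs
      obtain ⟨i, hi, rfl⟩ := List.mem_map.1 hs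
      simpa using (List.mem_filter.1 hi).2
    · intro s hs
      obtain ⟨i, hi, rfl⟩ := List.mem_map.1 hs
      exact (hl _ (List.get_mem l i)).resolve_left (by simpa using (List.mem_filter.1 hi).2)
  have h3 := hi l.length hlen l.get σ
  have h4 : List.ofFn (fun i => l.get (σ i) ^ 2) = (l1 ++ l2).map (· ^ 2) := by
    rw [← hσ, List.map_ofFn]
    rfl
  rw [h4, List.ofFn_get, (le_iff_himp _ _).1 hlu, one_pow, List.map_append, List.prod_append] at h3
  have h5 : (l2.map (· ^ 2)).prod = b ^ (2 * l2.length) := by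
    rw [List.eq_replicate_of_mem h2]
    simp [pow_mul]
  have h6 : (l1.map (· ^ 2)).prod ∈ V := by
    clear hσ h3 h4
    induction l1 with
    | nil => simpa using one_mem' hF
    | cons s l1 ih =>
      rw [List.map_cons, List.prod_cons]
      exact hF.2.1 _ (pow_mem' hF (h1 s (by simp)) 2) _
        (ih (fun t ht => h1 t (List.mem_cons_of_mem _ ht)))
  rw [h5, himp_mul] at h3
  have h7 : himp (b ^ (2 * l2.length)) u ∈ V :=
    hF.2.2 _ h6 _ ((le_iff_himp _ _).2 (le_antisymm (le_one'' _) h3))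
  have h8 : himp (b ^ (2 * l2.length + 1)) u ∈ V :=
    lem_trans hF (lem_of_le hF (pow_anti b (Nat.le_succ _))) h7
  have h9 := hF.2.2 _ (pow_mem' hF h8 2) _ (hab _ (by omega))
  exact huV (lem_mem hF (pow_mem' hF ha _) h9)

end basic

end PseudoHoop

/-- A unital basic pseudo hoop `(A, u)` has every maximal filter
normal iff it satisfies inequalities (i)-(iii). -/
theorem stmt_18 {A : Type*} [BasicPseudoHoop A] (u : A) (hu : IsStrongUnit u) :
    (∀ F : Set A, IsMaximalFilter F → IsNormalFilter F) ↔
      ((∀ (n : ℕ), 1 ≤ n → ∀ (x : Fin n → A) (π : Equiv.Perm (Fin n)),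
        PseudoHoop.himp (List.ofFn x).prod u ^ 2 ≤
          PseudoHoop.himp (List.ofFn (fun i => x (π i) ^ 2)).prod u) ∧
      (∀ (n : ℕ), 1 ≤ n → ∀ x y : A,
        PseudoHoop.himp (PseudoHoop.himp x y ^ n) u ^ 2 ≤
          PseudoHoop.himp (PseudoHoop.rimp x y ^ (2 * n)) u) ∧
      (∀ (n : ℕ), 1 ≤ n → ∀ x y : A,
        PseudoHoop.himp (PseudoHoop.rimp x y ^ n) u ^ 2 ≤
          PseudoHoop.himp (PseudoHoop.himp x y ^ (2 * n)) u)) := by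
  constructor
  · intro H
    refine ⟨?_, ?_, ?_⟩
    · intro n _ x π
      have h := main_ineq hu H (List.ofFn x).prod (List.ofFn (x ∘ π)) (by
        intro V hV hn hT
        exact perm_mod hV hn hT (Equiv.Perm.ofFn_comp_perm π x))
      rw [List.map_ofFn] at h
      exact h
    · intro n _ x y
      exact main_pow hu H _ _ n (fun V hV hn hT => rimp_himp_mod hV hn hT x y)
    · intro n _ x y
      exact main_pow hu H _ _ n (fun V hV hn hT => himp_rimp_mod hV hn hT x y)
  · rintro ⟨h1, h2, h3⟩ V hV x y
    constructor
    · intro h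
      exact half hu h1 hV _ _ h (fun n hn => h3 n hn x y)
    · intro h
      exact half hu h1 hV _ _ h (fun n hn => h2 n hn x y)
end
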